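/- arXiv:1311.5966 — 2 statements merged into one kernel-verified Lean document; each statement's English description precedes it below -/
import Mathlib

section
/- Suppose f₁ and f₂ are the uniform densities on [x_A,x_B] and [y_A,y_C]. Then there exist at most five items (q₁ⁱ, q₂ⁱ, tⁱ), 1 ≤ i ≤ 5, with q₁ⁱ ≥ 0, q₂ⁱ ≥ 0 and q₁ⁱ + q₂ⁱ ≤ 1, one of which is (0,0,0), such that u(x,y) = max_{1≤i≤5} (q₁ⁱ·x + q₂ⁱ·y − tⁱ) is an optimal unit-demand feasible utility function; that is, the optimal unit-demand mechanism consists of at most 5 menu items. -/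
open MeasureTheory Set

noncomputable section

/-- A positive, bounded, differentiable density on `[a,b]` integrating to 1. -/
def Density (a b : ℝ) (h : ℝ → ℝ) : Prop :=
  (∀ x ∈ Set.Icc a b, 0 < h x) ∧ (∃ M, ∀ x ∈ Set.Icc a b, h x ≤ M) ∧
  (∀ x ∈ Set.Icc a b, DifferentiableAt ℝ h x) ∧ (∫ x in a..b, h x) = 1

/-- The valuation rectangle `V = [xA,xB] × [yA,yC]`. -/
def V (xA xB yA yC : ℝ) : Set (ℝ × ℝ) := Set.Icc (xA, yA) (xB, yC)

/-- First partial derivative. -/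
def pd1 (u : ℝ × ℝ → ℝ) (z : ℝ × ℝ) : ℝ := fderiv ℝ u z (1, 0)

/-- Second partial derivative. -/
def pd2 (u : ℝ × ℝ → ℝ) (z : ℝ × ℝ) : ℝ := fderiv ℝ u z (0, 1)

/-- A feasible buyer utility function: nonnegative, convex, with increments in each
coordinate between `0` and the coordinate increment (partial derivatives in `[0,1]`). -/
def Feasible (xA xB yA yC : ℝ) (u : ℝ × ℝ → ℝ) : Prop :=
  (∀ z ∈ V xA xB yA yC, 0 ≤ u z) ∧
  ConvexOn ℝ (V xA xB yA yC) u ∧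
  (∀ x x' y, xA ≤ x → x ≤ x' → x' ≤ xB → y ∈ Set.Icc yA yC →
    0 ≤ u (x', y) - u (x, y) ∧ u (x', y) - u (x, y) ≤ x' - x) ∧
  (∀ x y y', x ∈ Set.Icc xA xB → yA ≤ y → y ≤ y' → y' ≤ yC →
    0 ≤ u (x, y') - u (x, y) ∧ u (x, y') - u (x, y) ≤ y' - y)

/-- The seller's expected revenue from utility function `u` under joint density
`f₁(x)·f₂(y)`. -/
def Rev (xA xB yA yC : ℝ) (f1 f2 : ℝ → ℝ) (u : ℝ × ℝ → ℝ) : ℝ :=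
  ∫ z in V xA xB yA yC, (z.1 * pd1 u z + z.2 * pd2 u z - u z) * (f1 z.1 * f2 z.2)

/-- The optimal revenue: supremum of revenue over feasible utility functions. -/
def OptRev (xA xB yA yC : ℝ) (f1 f2 : ℝ → ℝ) : ℝ :=
  sSup {r | ∃ u, Feasible xA xB yA yC u ∧ r = Rev xA xB yA yC f1 f2 u}

/-- A feasible utility function is optimal if its revenue attains the supremum. -/
def Optimal (xA xB yA yC : ℝ) (f1 f2 : ℝ → ℝ) (u : ℝ × ℝ → ℝ) : Prop :=
  Feasible xA xB yA yC u ∧ Rev xA xB yA yC f1 f2 u = OptRev xA xB yA yC f1 f2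

/-- The power rate of a density `h`: `PR(h)(x) = x·h'(x)/h(x)`. -/
def PR (h : ℝ → ℝ) (x : ℝ) : ℝ := x * deriv h x / h x

/-- The bundling revenue `BRev = sup_{p ≥ 0} p · ∫_{x+y ≥ p} f`. -/
def BRev (xA xB yA yC : ℝ) (f1 f2 : ℝ → ℝ) : ℝ :=
  sSup {r | ∃ p, 0 ≤ p ∧
    r = p * ∫ z in {z ∈ V xA xB yA yC | p ≤ z.1 + z.2}, f1 z.1 * f2 z.2}

/-- The payment associated with utility `u` at a point of differentiability. -/
def pay (u : ℝ × ℝ → ℝ) (z : ℝ × ℝ) : ℝ := pd1 u z * z.1 + pd2 u z * z.2 - u z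

/-- A unit-demand feasible utility: nonnegative, convex, with (a.e.-defined) partial
derivatives satisfying `∂₁u ≥ 0`, `∂₂u ≥ 0`, `∂₁u + ∂₂u ≤ 1`. -/
def UDFeasible (xA xB yA yC : ℝ) (u : ℝ × ℝ → ℝ) : Prop :=
  (∀ z ∈ V xA xB yA yC, 0 ≤ u z) ∧
  ConvexOn ℝ (V xA xB yA yC) u ∧
  ∀ z ∈ V xA xB yA yC, DifferentiableAt ℝ u z →
    0 ≤ pd1 u z ∧ 0 ≤ pd2 u z ∧ pd1 u z + pd2 u z ≤ 1

/-- A unit-demand feasible utility is optimal if its revenue attains the supremum of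
revenue over unit-demand feasible utilities. -/
def UDOptimal (xA xB yA yC : ℝ) (f1 f2 : ℝ → ℝ) (u : ℝ × ℝ → ℝ) : Prop :=
  UDFeasible xA xB yA yC u ∧
  Rev xA xB yA yC f1 f2 u =
    sSup {r | ∃ v, UDFeasible xA xB yA yC v ∧ r = Rev xA xB yA yC f1 f2 v}

/-- Contribution of one diagonal to the revenue, where `W` and `w` are the coordinates of the
edges at the top and bottom end, and `s`, `r` the heights of the two ends above the threshold. -/
def gain (W w s r : ℝ) : ℝ :=
  W * max 0 s - w * max 0 r - 3 / 2 * ((max 0 s) ^ 2 - (max 0 r) ^ 2)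

lemma gain_le_of_le_max {b w l q q' : ℝ} (hb : 0 ≤ b) (hl : l ≤ b)
    (hk : 0 ≤ 2 * b - 3 * l + w) (hq : q ≤ q') (hq' : q' ≤ max l (2 * b / 3)) :
    gain b w (b - q) (l - q) ≤ gain b w (b - q') (l - q') := by
  have hq'b : q' ≤ b := hq'.trans (max_le hl (by linarith))
  unfold gain
  rw [max_eq_right (by linarith : 0 ≤ b - q), max_eq_right (by linarith : 0 ≤ b - q')]
  rcases le_total l q with h | h
  · rw [max_eq_left (by linarith : l - q ≤ 0), max_eq_left (by linarith : l - q' ≤ 0)]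
    rcases le_max_iff.1 hq' with h' | h'
    · have : q = q' := by linarith
      subst this; linarith
    · nlinarith
  · rw [max_eq_right (by linarith : 0 ≤ l - q)]
    rcases le_total l q' with h1 | h1
    · rw [max_eq_left (by linarith : l - q' ≤ 0)]
      rcases le_max_iff.1 hq' with h' | h'
      · have : q' = l := by linarith
        subst this; nlinarith
      · nlinarith [mul_nonneg (sub_nonneg.2 h) hk,
          mul_nonneg (sub_nonneg.2 h1) (by linarith : 0 ≤ 2 * b - 3 * q')]
    · rw [max_eq_right (by linarith : 0 ≤ l - q')]
      nlinarith

lemma gain_le_of_max_le {b w l q q' : ℝ} (hb : 0 ≤ b) (hq : q' ≤ q)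
    (hq' : max l (2 * b / 3) ≤ q') :
    gain b w (b - q) (l - q) ≤ gain b w (b - q') (l - q') := by
  obtain ⟨h1, h2⟩ := max_le_iff.1 hq'
  unfold gain
  rw [max_eq_left (by linarith : l - q ≤ 0), max_eq_left (by linarith : l - q' ≤ 0)]
  rcases le_total b q with h | h <;> rcases le_total b q' with h' | h'
  · rw [max_eq_left (by linarith : b - q ≤ 0), max_eq_left (by linarith : b - q' ≤ 0)]
  · rw [max_eq_left (by linarith : b - q ≤ 0), max_eq_right (by linarith : 0 ≤ b - q')]
    nlinarith
  · rw [max_eq_right (by linarith : 0 ≤ b - q), max_eq_left (by linarith : b - q' ≤ 0)]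
    nlinarith
  · rw [max_eq_right (by linarith : 0 ≤ b - q), max_eq_right (by linarith : 0 ≤ b - q')]
    nlinarith

lemma gain_antitone {b w l q q' : ℝ} (hb : 0 ≤ b) (hl : l ≤ b) (hw : 0 ≤ w)
    (hk : 2 * b - 3 * l + w ≤ 0) (hq : q' ≤ q) :
    gain b w (b - q) (l - q) ≤ gain b w (b - q') (l - q') := by
  have hm : max l (2 * b / 3) = l := max_eq_left (by linarith)
  have key : ∀ {q q' : ℝ}, q' ≤ q → q ≤ l →
      gain b w (b - q) (l - q) ≤ gain b w (b - q') (l - q') := by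
    intro q q' h h'
    unfold gain
    rw [max_eq_right (by linarith : 0 ≤ b - q), max_eq_right (by linarith : 0 ≤ b - q'),
      max_eq_right (by linarith : 0 ≤ l - q), max_eq_right (by linarith : 0 ≤ l - q')]
    nlinarith
  rcases le_total l q' with h | h
  · exact gain_le_of_max_le hb hq (hm.le.trans h)
  · rcases le_total l q with h1 | h1
    · exact (gain_le_of_max_le hb h1 hm.le).trans (key h le_rfl)
    · exact key hq h1

/-- A concave function on `[m, M]` whose slopes lie in `[-1, 0]`. -/
structure Threshold (m M : ℝ) (p : ℝ → ℝ) : Prop where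
  concave : ConcaveOn ℝ (Icc m M) p
  anti : ∀ x ∈ Icc m M, ∀ y ∈ Icc m M, x ≤ y → p y ≤ p x
  slope : ∀ x ∈ Icc m M, ∀ y ∈ Icc m M, x ≤ y → p x ≤ p y + (y - x)

lemma ConcaveOn.mul_le_three {S : Set ℝ} {p : ℝ → ℝ} (hp : ConcaveOn ℝ S p) {x y z : ℝ}
    (hx : x ∈ S) (hz : z ∈ S) (hxy : x ≤ y) (hyz : y ≤ z) :
    (z - y) * p x + (y - x) * p z ≤ (z - x) * p y := by
  rcases eq_or_lt_of_le (hxy.trans hyz) with h | h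
  · have h1 : y = x := by linarith
    subst h1; subst h; simp
  · have h0 : 0 < z - x := by linarith
    have := hp.2 hx hz (div_nonneg (by linarith : 0 ≤ z - y) h0.le)
      (div_nonneg (by linarith : 0 ≤ y - x) h0.le) (by field_simp; ring)
    simp only [smul_eq_mul] at this
    have e : (z - y) / (z - x) * x + (y - x) / (z - x) * z = y := by field_simp; ring
    rw [e] at this
    have h2 := mul_le_mul_of_nonneg_left this h0.le
    have e2 : (z - x) * ((z - y) / (z - x) * p x + (y - x) / (z - x) * p z)
        = (z - y) * p x + (y - x) * p z := by field_simp
    linarith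

lemma Threshold.exists_chord {m M : ℝ} {p : ℝ → ℝ} (hp : Threshold m M p) {α a : ℝ}
    (hα : α ∈ Icc m M) (ha : a ∈ Icc m M) (hαa : α ≤ a) :
    ∃ s c : ℝ, -1 ≤ s ∧ s ≤ 0 ∧ c + s * α = p α ∧ c + s * a = p a ∧
      (∀ x ∈ Icc α a, c + s * x ≤ p x) ∧
      (∀ x ∈ Icc m M, x ≤ α ∨ a ≤ x → p x ≤ c + s * x) := by
  rcases eq_or_lt_of_le hαa with h | h
  · subst h
    suffices ∃ s : ℝ, -1 ≤ s ∧ s ≤ 0 ∧ ∀ x ∈ Icc m M, p x ≤ p α + s * (x - α) by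
      obtain ⟨s, h1, h2, h3⟩ := this
      refine ⟨s, p α - s * α, h1, h2, by ring, by ring, ?_, ?_⟩
      · intro x hx
        obtain rfl : x = α := le_antisymm hx.2 hx.1
        linarith
      · intro x hx _
        have := h3 x hx
        linarith
    rcases eq_or_lt_of_le hα.2 with hM | hM
    · refine ⟨-1, le_rfl, by norm_num, fun x hx => ?_⟩
      have := hp.slope x hx α hα (by rw [hM]; exact hx.2)
      linarith
    · set T : Set ℝ := (fun y => (p y - p α) / (y - α)) '' Ioc α M with hT
      have hTne : T.Nonempty := ⟨_, M, ⟨hM, le_rfl⟩, rfl⟩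
      have hTub : ∀ t ∈ T, t ≤ 0 := by
        rintro _ ⟨y, hy, rfl⟩
        have := hp.anti α hα y ⟨hα.1.trans hy.1.le, hy.2⟩ hy.1.le
        exact div_nonpos_of_nonpos_of_nonneg (by linarith) (by linarith [hy.1])
      have hTlb : ∀ t ∈ T, -1 ≤ t := by
        rintro _ ⟨y, hy, rfl⟩
        have := hp.slope α hα y ⟨hα.1.trans hy.1.le, hy.2⟩ hy.1.le
        rw [le_div_iff₀ (by linarith [hy.1])]
        linarith
      have hbdd : BddAbove T := ⟨0, hTub⟩
      refine ⟨sSup T, ?_, csSup_le hTne hTub, fun x hx => ?_⟩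
      · obtain ⟨t, ht⟩ := hTne
        exact (hTlb t ht).trans (le_csSup hbdd ht)
      · rcases lt_trichotomy x α with hxα | rfl | hxα
        · have : sSup T ≤ (p α - p x) / (α - x) := by
            refine csSup_le hTne ?_
            rintro _ ⟨y, hy, rfl⟩
            have hy' : y ∈ Icc m M := ⟨hα.1.trans hy.1.le, hy.2⟩
            have := hp.concave.mul_le_three hx hy' hxα.le hy.1.le
            rw [div_le_div_iff₀ (by linarith [hy.1]) (by linarith)]
            linarith
          rw [le_div_iff₀ (by linarith)] at this
          linarith
        · simp
        · have : (p x - p α) / (x - α) ≤ sSup T := le_csSup hbdd ⟨x, ⟨hxα, hx.2⟩, rfl⟩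
          rw [div_le_iff₀ (by linarith)] at this
          linarith
  · have h0 : 0 < a - α := by linarith
    have hs : (p a - p α) / (a - α) * (a - α) = p a - p α := by field_simp
    set s := (p a - p α) / (a - α)
    have he : ∀ x, (a - α) * (p α - s * α + s * x) = (a - x) * p α + (x - α) * p a := fun x => by
      linear_combination (x - α) * hs
    refine ⟨s, p α - s * α, ?_, ?_, by ring, by linarith, ?_, ?_⟩
    · have := hp.slope α hα a ha hαa
      by_contra! hc
      nlinarith
    · have := hp.anti α hα a ha hαa
      by_contra! hc
      nlinarith
    · intro x hx
      have := hp.concave.mul_le_three hα ha hx.1 hx.2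
      exact le_of_mul_le_mul_left ((he x).le.trans this) h0
    · rintro x hx (h' | h')
      · have := hp.concave.mul_le_three hx ha h' hαa
        exact le_of_mul_le_mul_left (by linarith [he x]) h0
      · have := hp.concave.mul_le_three hα hx hαa h'
        exact le_of_mul_le_mul_left (by linarith [he x]) h0

lemma Threshold.continuousOn {m M : ℝ} {p : ℝ → ℝ} (hp : Threshold m M p) :
    ContinuousOn p (Icc m M) := by
  refine (LipschitzOnWith.of_dist_le_mul (K := 1) fun x hx y hy => ?_).continuousOn
  rw [Real.dist_eq, Real.dist_eq, NNReal.coe_one, one_mul]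
  rcases le_total x y with h | h
  · have h1 := hp.anti x hx y hy h
    have h2 := hp.slope x hx y hy h
    rw [abs_of_nonneg (by linarith), abs_of_nonpos (by linarith)]
    linarith
  · have h1 := hp.anti y hy x hx h
    have h2 := hp.slope y hy x hx h
    rw [abs_of_nonpos (by linarith), abs_of_nonneg (by linarith)]
    linarith

lemma Threshold.two_lines {xA yA b m d M : ℝ} {p w : ℝ → ℝ} (hp : Threshold m M p)
    (hx : 0 ≤ xA) (hy : 0 ≤ yA) (hyb : yA ≤ b) (hm : xA - b ≤ m) (hmd : m ≤ d) (hdM : d ≤ M)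
    (hw1 : ∀ t < xA - yA, w t = xA) (hw2 : ∀ t > xA - yA, w t = yA)
    (hw3 : w (xA - yA) = xA ∨ w (xA - yA) = yA) :
    ∃ s₁ c₁ s₂ c₂ : ℝ, (-1 ≤ s₁ ∧ s₁ ≤ 0) ∧ (-1 ≤ s₂ ∧ s₂ ≤ 0) ∧
      (∃ e ∈ Icc m M, c₁ + s₁ * e = p e) ∧ (∃ e ∈ Icc m M, c₂ + s₂ * e = p e) ∧
      (∀ t ∈ Icc d M, p t ≤ c₁ + s₁ * t) ∧ (∀ t ∈ Icc d M, p t ≤ c₂ + s₂ * t) ∧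
      ∀ t ∈ Icc m d, ∀ c, p t ≤ c →
        gain b (w t) (b - p t) (max yA (xA - t) - p t) ≤
        gain b (w t) (b - min (min (c₁ + s₁ * t) (c₂ + s₂ * t)) c)
          (max yA (xA - t) - min (min (c₁ + s₁ * t) (c₂ + s₂ * t)) c) := by
  have hb : 0 ≤ b := hy.trans hyb
  set t₀ := min (xA - yA) (-2 * (b - xA) / 3) with ht₀
  set e := min (max t₀ m) d with he
  have hem : m ≤ e := le_min (le_max_right _ _) hmd
  have hed : e ≤ d := min_le_right _ _
  have heM : e ∈ Icc m M := ⟨hem, hed.trans hdM⟩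
  set μ := max yA (2 * b / 3) with hμ
  set k := xA - μ with hk
  set k' := min (max k e) d with hk'
  have hek' : e ≤ k' := le_min (le_max_right _ _) hed
  have hk'd : k' ≤ d := min_le_right _ _
  have hk1 : e < k' → k' ≤ k := by
    intro h
    rcases le_total k e with h1 | h1
    · rw [hk', max_eq_right h1] at h
      exact absurd h (not_lt.2 (min_le_left _ _))
    · rw [hk', max_eq_left h1]; exact min_le_left _ _
  have hk2 : k' < d → k ≤ k' := by
    intro h
    rcases le_total (max k e) d with h1 | h1
    · rw [hk', min_eq_left h1]; exact le_max_left _ _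
    · rw [hk', min_eq_right h1] at h
      exact absurd h (lt_irrefl _)
  set f : ℝ → ℝ := fun t => max (xA - t) μ with hf
  have hfc : Continuous f := by fun_prop
  have hpc := hp.continuousOn
  have hsub : ∀ {u v}, e ≤ u → v ≤ d → Icc u v ⊆ Icc m M := fun h1 h2 =>
    Icc_subset_Icc (hem.trans h1) (h2.trans hdM)
  obtain ⟨α, a, heα, hαa, had, hin, hα, ha⟩ : ∃ α a, e ≤ α ∧ α ≤ a ∧ a ≤ d ∧
      (α = a ∨ (f α ≤ p α ∧ f a ≤ p a)) ∧ (e < α → α ≤ k ∧ p α ≤ f α) ∧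
      (a < d → k ≤ a ∧ p a ≤ f a) := by
    rcases le_total (p k') (f k') with h | h
    · exact ⟨k', k', hek', le_rfl, hk'd, Or.inl rfl, fun h' => ⟨hk1 h', h⟩, fun h' => ⟨hk2 h', h⟩⟩
    · obtain ⟨α, h1, h2, h3, h4⟩ : ∃ α, e ≤ α ∧ α ≤ k' ∧ f α ≤ p α ∧
          (e < α → α ≤ k ∧ p α ≤ f α) := by
        rcases le_total (f e) (p e) with h' | h'
        · exact ⟨e, le_rfl, hek', h', fun h => absurd h (lt_irrefl _)⟩
        · obtain ⟨α, hα, hα'⟩ := intermediate_value_Icc hek'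
            ((hpc.mono (hsub le_rfl hk'd)).sub hfc.continuousOn)
            (show (0 : ℝ) ∈ Icc _ _ from ⟨by simpa using h', by simpa using h⟩)
          simp only [Pi.sub_apply] at hα'
          exact ⟨α, hα.1, hα.2, by linarith,
            fun h => ⟨hα.2.trans (hk1 (h.trans_le hα.2)), by linarith⟩⟩
      obtain ⟨a, g1, g2, g3, g4⟩ : ∃ a, k' ≤ a ∧ a ≤ d ∧ f a ≤ p a ∧
          (a < d → k ≤ a ∧ p a ≤ f a) := by
        rcases le_total (f d) (p d) with h' | h'
        · exact ⟨d, hk'd, le_rfl, h', fun h => absurd h (lt_irrefl _)⟩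
        · obtain ⟨a, ha, ha'⟩ := intermediate_value_Icc' hk'd
            ((hpc.mono (hsub hek' le_rfl)).sub hfc.continuousOn)
            (show (0 : ℝ) ∈ Icc _ _ from ⟨by simpa using h', by simpa using h⟩)
          simp only [Pi.sub_apply] at ha'
          exact ⟨a, ha.1, ha.2, by linarith,
            fun h => ⟨(hk2 (ha.1.trans_lt h)).trans ha.1, by linarith⟩⟩
      exact ⟨α, a, h1, h2.trans g1, g2, Or.inr ⟨h3, g3⟩, h4, g4⟩
  obtain ⟨s, c, hs1, hs0, hcα, hca, hle, hge⟩ := hp.exists_chord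
    (hsub le_rfl le_rfl ⟨heα, hαa.trans had⟩ : α ∈ Icc m M)
    (hsub le_rfl le_rfl ⟨heα.trans hαa, had⟩ : a ∈ Icc m M) hαa
  refine ⟨0, p e, s, c, ⟨by norm_num, le_rfl⟩, ⟨hs1, hs0⟩, ⟨e, heM, by ring⟩,
    ⟨a, hsub le_rfl le_rfl ⟨heα.trans hαa, had⟩, hca⟩, ?_, ?_, ?_⟩
  · intro t ht
    have := hp.anti e heM t ⟨hmd.trans ht.1, ht.2⟩ (hed.trans ht.1)
    linarith
  · exact fun t ht => hge t ⟨hmd.trans ht.1, ht.2⟩ (Or.inr (had.trans ht.1))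
  intro t ht c' hc'
  have htM : t ∈ Icc m M := ⟨ht.1, ht.2.trans hdM⟩
  have hl : max yA (xA - t) ≤ b := max_le hyb (by linarith [ht.1])
  have hfl : max (max yA (xA - t)) (2 * b / 3) = f t := by
    simp only [hf, hμ]
    rw [max_comm yA, max_assoc]
  rw [zero_mul, add_zero]
  rcases lt_trichotomy t e with hte | hte | hte
  · have htt : t < t₀ := by
      have := (hte.trans_le (min_le_left _ _))
      exact (lt_max_iff.1 this).resolve_right (not_lt.2 ht.1)
    have hw := hw1 t (htt.trans_le (min_le_left _ _))
    have h2 := htt.trans_le (min_le_right _ _)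
    have h1 := htt.trans_le (min_le_left _ _)
    refine gain_antitone hb hl (by rw [hw]; exact hx) ?_ ?_
    · rw [hw, max_eq_right (by linarith)]
      linarith
    · exact (min_le_left _ _).trans ((min_le_left _ _).trans (hp.anti t htM e heM hte.le))
  · have : p t ≤ c + s * t := hge t htM (Or.inl (hte.le.trans heα))
    rw [← hte]
    rw [min_eq_left this, min_eq_left hc']
  · have het : t₀ ≤ t := by
      have hed' : e < d := hte.trans_le ht.2
      have : max t₀ m ≤ e := by
        rcases le_total (max t₀ m) d with h | h
        · rw [he, min_eq_left h]
        · rw [he, min_eq_right h] at hed'; exact absurd hed' (lt_irrefl _)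
      exact (le_max_left _ _).trans (this.trans hte.le)
    have hkap : 0 ≤ 2 * b - 3 * max yA (xA - t) + w t := by
      rcases lt_trichotomy t (xA - yA) with h | h | h
      · rw [hw1 t h, max_eq_right (by linarith)]
        rcases min_le_iff.1 het with h' | h' <;> linarith
      · rw [h, max_eq_left (by linarith)]
        rcases hw3 with h3 | h3 <;> rw [h3]
        · have : t₀ < t := by
            have hed' : e < d := hte.trans_le ht.2
            refine lt_of_le_of_lt ?_ hte
            refine (le_max_left _ m).trans ?_
            rcases le_total (max t₀ m) d with h | h
            · rw [he, min_eq_left h]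
            · rw [he, min_eq_right h] at hed'; exact absurd hed' (lt_irrefl _)
          rcases min_lt_iff.1 this with h' | h' <;> linarith
        · linarith
      · rw [hw2 t h]
        rcases max_cases yA (xA - t) with h' | h' <;> rw [h'.1] <;> linarith
    have hA : p t ≤ p e := hp.anti e heM t htM hte.le
    by_cases hz : t ∈ Icc α a
    · rcases hin with rfl | ⟨h1, h2⟩
      · obtain rfl : t = α := le_antisymm hz.2 hz.1
        rw [hcα, min_eq_right hA, min_eq_left hc']
      have hfg : f t ≤ c + s * t := by
        simp only [hf] at h1 h2 ⊢
        rw [← hcα] at h1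
        rw [← hca] at h2
        refine max_le ?_ ?_
        · have := (le_max_left _ _).trans h1
          nlinarith [hz.1]
        · have := (le_max_right _ _).trans h2
          nlinarith [hz.2]
      have hgp := hle t hz
      refine gain_le_of_max_le hb ((min_le_left _ _).trans ((min_le_right _ _).trans hgp)) ?_
      rw [hfl]
      exact le_min (le_min (hfg.trans (hgp.trans hA)) hfg) (hfg.trans (hgp.trans hc'))
    · have hout : t ≤ α ∨ a ≤ t := by
        by_contra! h
        exact hz ⟨h.1.le, h.2.le⟩
      refine gain_le_of_le_max hb hl hkap (le_min (le_min hA (hge t htM hout)) hc') ?_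
      rw [hfl]
      refine (min_le_left _ _).trans ((min_le_right _ _).trans ?_)
      rcases le_or_gt α t with h1 | h1
      · have h2 : a < t := by
          by_contra! h
          exact hz ⟨h1, h⟩
        obtain ⟨h3, h4⟩ := ha (h2.trans_le ht.2)
        have : f a = μ := max_eq_right (by linarith)
        calc c + s * t ≤ c + s * a := by nlinarith
          _ ≤ μ := by rw [hca, ← this]; exact h4
          _ ≤ f t := le_max_right _ _
      · obtain ⟨h3, h4⟩ := hα (hte.trans h1)
        have : f α = xA - α := max_eq_left (by linarith)
        calc c + s * t ≤ c + s * α + (α - t) := by nlinarith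
          _ ≤ xA - t := by rw [hcα]; linarith
          _ ≤ f t := le_max_left _ _

/-- Height of the lower end of the diagonal `x - y = t` in the rectangle. -/
def lowEnd (xA yA t : ℝ) : ℝ := max yA (xA - t)

/-- Height of the upper end of the diagonal `x - y = t` in the rectangle. -/
def topEnd (xB yC t : ℝ) : ℝ := min yC (xB - t)

/-- Coordinate of the left or bottom edge met by the diagonal `x - y = t`. -/
def lowWeight (xA yA t : ℝ) : ℝ := if t < xA - yA then xA else yA

/-- Coordinate of the top or right edge met by the diagonal `x - y = t`. -/
def topWeight (xB yC t : ℝ) : ℝ := if t < xB - yC then yC else xB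

/-- Revenue on the diagonal `x - y = t` of the mechanism that sells above height `q`. -/
def diagGain (xA xB yA yC t q : ℝ) : ℝ :=
  gain (topWeight xB yC t) (lowWeight xA yA t) (topEnd xB yC t - q) (lowEnd xA yA t - q)

/-- Minimum of the four affine functions `c i + s i * t`. -/
def minLine (s c : Fin 4 → ℝ) (t : ℝ) : ℝ :=
  min (min (c 0 + s 0 * t) (c 1 + s 1 * t)) (min (c 2 + s 2 * t) (c 3 + s 3 * t))

lemma Threshold.reflect {m M : ℝ} {p : ℝ → ℝ} (hp : Threshold m M p) :
    Threshold (-M) (-m) (fun t => p (-t) - t) := by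
  have hmem : ∀ {t}, t ∈ Icc (-M) (-m) → -t ∈ Icc m M := fun h =>
    ⟨by linarith [h.2], by linarith [h.1]⟩
  refine ⟨⟨convex_Icc _ _, ?_⟩, ?_, ?_⟩
  · intro x hx y hy a b ha hb hab
    have := hp.concave.2 (hmem hx) (hmem hy) ha hb hab
    simp only [smul_eq_mul] at this ⊢
    rw [show a * -x + b * -y = -(a * x + b * y) by ring] at this
    linarith
  · intro x hx y hy h
    have := hp.slope _ (hmem hy) _ (hmem hx) (neg_le_neg h)
    linarith
  · intro x hx y hy h
    have := hp.anti _ (hmem hy) _ (hmem hx) (neg_le_neg h)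
    linarith

lemma Threshold.four_lines {xA xB yA yC : ℝ} {p : ℝ → ℝ} (h0 : 0 ≤ xA) (h1 : xA < xB)
    (h2 : 0 ≤ yA) (h3 : yA < yC) (hp : Threshold (xA - yC) (xB - yA) p) :
    ∃ s c : Fin 4 → ℝ, (∀ i, -1 ≤ s i ∧ s i ≤ 0) ∧
      (∀ i, ∃ e ∈ Icc (xA - yC) (xB - yA), c i + s i * e = p e) ∧
      ∀ t ∈ Icc (xA - yC) (xB - yA),
        diagGain xA xB yA yC t (p t) ≤ diagGain xA xB yA yC t (minLine s c t) := by
  obtain ⟨s₁, c₁, s₂, c₂, hs₁, hs₂, he₁, he₂, hd₁, hd₂, hL⟩ :=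
    hp.two_lines (d := xB - yC) (w := lowWeight xA yA) h0 h2 h3.le le_rfl (by linarith)
      (by linarith) (fun t ht => if_pos ht) (fun t ht => if_neg (not_lt.2 (le_of_lt ht)))
      (Or.inr (if_neg (lt_irrefl _)))
  obtain ⟨s₃, c₃, s₄, c₄, hs₃, hs₄, ⟨e₃, he₃, hc₃⟩, ⟨e₄, he₄, hc₄⟩, hd₃, hd₄, hR⟩ :=
    hp.reflect.two_lines (xA := yA) (yA := xA) (b := xB) (d := -(xB - yC))
      (w := fun t => lowWeight xA yA (-t)) h2 h0 h1.le (by linarith) (by linarith)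
      (by linarith) (fun t ht => if_neg (by linarith))
      (fun t ht => if_pos (by linarith)) (Or.inl (if_neg (by simp)))
  refine ⟨![s₁, s₂, -1 - s₃, -1 - s₄], ![c₁, c₂, c₃, c₄], ?_, ?_, ?_⟩
  · intro i
    fin_cases i
    · exact hs₁
    · exact hs₂
    · exact ⟨by simp; linarith [hs₃.2], by simp; linarith [hs₃.1]⟩
    · exact ⟨by simp; linarith [hs₄.2], by simp; linarith [hs₄.1]⟩
  · intro i
    fin_cases i
    · exact he₁
    · exact he₂
    · refine ⟨-e₃, ⟨by linarith [he₃.2], by linarith [he₃.1]⟩, ?_⟩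
      simp
      linarith
    · refine ⟨-e₄, ⟨by linarith [he₄.2], by linarith [he₄.1]⟩, ?_⟩
      simp
      linarith
  · intro t ht
    simp only [diagGain, minLine, Matrix.cons_val]
    rcases lt_or_ge t (xB - yC) with h | h
    · have e1 : topEnd xB yC t = yC := min_eq_left (by linarith)
      have e2 : topWeight xB yC t = yC := if_pos h
      rw [e1, e2]
      refine hL t ⟨ht.1, h.le⟩ _ (le_min ?_ ?_)
      · have := hd₃ (-t) ⟨by linarith, by linarith [ht.1]⟩
        rw [neg_neg] at this
        linarith
      · have := hd₄ (-t) ⟨by linarith, by linarith [ht.1]⟩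
        rw [neg_neg] at this
        linarith
    · have e1 : topEnd xB yC t = xB - t := min_eq_right (by linarith)
      have e2 : topWeight xB yC t = xB := if_neg (not_lt.2 h)
      rw [e1, e2]
      have key := hR (-t) ⟨by linarith [ht.2], by linarith⟩
        (min (c₁ + s₁ * t) (c₂ + s₂ * t) + t) (by
          have := le_min (hd₁ t ⟨h, ht.2⟩) (hd₂ t ⟨h, ht.2⟩)
          simp only [neg_neg]
          linarith)
      have e3 : min (min (c₃ + s₃ * -t) (c₄ + s₄ * -t)) (min (c₁ + s₁ * t) (c₂ + s₂ * t) + t)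
          = min (min (c₁ + s₁ * t) (c₂ + s₂ * t))
            (min (c₃ + (-1 - s₃) * t) (c₄ + (-1 - s₄) * t)) + t := by
        rw [min_comm, ← min_add_add_right (min (c₁ + s₁ * t) (c₂ + s₂ * t)),
          ← min_add_add_right (c₃ + (-1 - s₃) * t)]
        congr 2 <;> ring
      have e4 : max xA (yA - -t) = lowEnd xA yA t + t := by
        rw [lowEnd, ← max_add_add_right, max_comm]
        congr 1 <;> ring
      simp only [neg_neg, e3, e4] at key
      convert key using 2 <;> ring

/-- Convex functions on the plane with gradients in the simplex `q₁, q₂ ≥ 0`, `q₁ + q₂ ≤ 1`. -/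
structure IsUtility (v : ℝ × ℝ → ℝ) : Prop where
  sub_le : ∀ z w, v z - v w ≤ max 0 (max (z.1 - w.1) (z.2 - w.2))
  convex : ConvexOn ℝ univ v

lemma IsUtility.lipschitz {v : ℝ × ℝ → ℝ} (hv : IsUtility v) : LipschitzWith 1 v := by
  have key : ∀ z w, v z - v w ≤ dist z w := fun z w => by
    refine (hv.sub_le z w).trans (max_le dist_nonneg ?_)
    rw [Prod.dist_eq, Real.dist_eq, Real.dist_eq]
    exact max_le_max (le_abs_self _) (le_abs_self _)
  refine LipschitzWith.of_dist_le_mul fun z w => ?_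
  rw [Real.dist_eq, NNReal.coe_one, one_mul, abs_le]
  exact ⟨by linarith [key w z, dist_comm z w], key z w⟩

/-- The price along the diagonals induced by the values of `v` on the top and right edges. -/
def edgePrice (xB yC : ℝ) (v : ℝ × ℝ → ℝ) (t : ℝ) : ℝ :=
  topEnd xB yC t - v (t + topEnd xB yC t, topEnd xB yC t)

lemma topEnd_anti (xB yC : ℝ) {t t' : ℝ} (h : t ≤ t') : topEnd xB yC t' ≤ topEnd xB yC t :=
  min_le_min le_rfl (by linarith)

lemma topEnd_slope (xB yC : ℝ) {t t' : ℝ} (h : t ≤ t') :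
    t + topEnd xB yC t ≤ t' + topEnd xB yC t' := by
  unfold topEnd
  rcases min_cases yC (xB - t) with h1 | h1 <;> rcases min_cases yC (xB - t') with h2 | h2 <;>
    rw [h1.1, h2.1] <;> linarith [h1.2, h2.2]

lemma topEnd_concave (xB yC : ℝ) {t t' a b : ℝ} (ha : 0 ≤ a) (hb : 0 ≤ b) (hab : a + b = 1) :
    a * topEnd xB yC t + b * topEnd xB yC t' ≤ topEnd xB yC (a * t + b * t') := by
  have h1 : topEnd xB yC t ≤ yC := min_le_left _ _
  have h2 : topEnd xB yC t ≤ xB - t := min_le_right _ _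
  have h3 : topEnd xB yC t' ≤ yC := min_le_left _ _
  have h4 : topEnd xB yC t' ≤ xB - t' := min_le_right _ _
  obtain rfl : b = 1 - a := by linarith
  refine le_min ?_ ?_ <;> nlinarith

lemma IsUtility.threshold {v : ℝ × ℝ → ℝ} (hv : IsUtility v) (xB yC m M : ℝ) :
    Threshold m M (edgePrice xB yC v) := by
  refine ⟨⟨convex_Icc _ _, ?_⟩, ?_, ?_⟩
  · intro x _ y _ a b ha hb hab
    simp only [smul_eq_mul, edgePrice]
    have h1 := topEnd_concave xB yC (t := x) (t' := y) ha hb hab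
    set H := topEnd xB yC (a * x + b * y)
    set hx := topEnd xB yC x
    set hy := topEnd xB yC y
    have h2 := hv.convex.2 (mem_univ (x + hx, hx)) (mem_univ (y + hy, hy)) ha hb hab
    have h3 := hv.sub_le (a * x + b * y + H, H) (a • (x + hx, hx) + b • (y + hy, hy))
    simp only [Prod.fst_add, Prod.smul_fst, Prod.snd_add, Prod.smul_snd, smul_eq_mul] at h2 h3
    have h4 : max 0 (max (a * x + b * y + H - (a * (x + hx) + b * (y + hy)))
        (H - (a * hx + b * hy))) ≤ H - (a * hx + b * hy) :=
      max_le (by linarith) (max_le (by linarith) le_rfl)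
    linarith
  · intro x _ y _ h
    have h1 := topEnd_anti xB yC h
    have h2 := topEnd_slope xB yC h
    unfold edgePrice
    set hx := topEnd xB yC x
    set hy := topEnd xB yC y
    have h3 := hv.sub_le (x + hx, hx) (y + hy, hy)
    have h4 : max 0 (max (x + hx - (y + hy)) (hx - hy)) ≤ hx - hy :=
      max_le (by linarith) (max_le (by linarith) le_rfl)
    simp only at h3
    linarith
  · intro x _ y _ h
    have h1 := topEnd_anti xB yC h
    have h2 := topEnd_slope xB yC h
    unfold edgePrice
    set hx := topEnd xB yC x
    set hy := topEnd xB yC y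
    have h3 := hv.sub_le (y + hy, hy) (x + hx, hx)
    have h4 : max 0 (max (y + hy - (x + hx)) (hy - hx)) ≤ y + hy - (x + hx) :=
      max_le (by linarith) (max_le le_rfl (by linarith))
    simp only at h3
    linarith

/-- The part of the revenue functional carried by the diagonal `x - y = t`. -/
def diagRev (xA xB yA yC : ℝ) (v : ℝ × ℝ → ℝ) (t : ℝ) : ℝ :=
  topWeight xB yC t * v (t + topEnd xB yC t, topEnd xB yC t)
    - lowWeight xA yA t * v (t + lowEnd xA yA t, lowEnd xA yA t)
    - 3 * ∫ s in (lowEnd xA yA t)..(topEnd xB yC t), v (t + s, s)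

lemma hasDerivAt_max_zero_sq (x : ℝ) : HasDerivAt (fun x : ℝ => (max 0 x) ^ 2 / 2) (max 0 x) x := by
  rcases lt_trichotomy x 0 with h | rfl | h
  · rw [max_eq_left h.le]
    refine (hasDerivAt_const x (0 : ℝ)).congr_of_eventuallyEq ?_
    filter_upwards [gt_mem_nhds h] with y hy
    rw [max_eq_left hy.le]; simp
  · rw [max_self, hasDerivAt_iff_isLittleO_nhds_zero]
    refine Asymptotics.IsBigO.trans_isLittleO (g := fun h : ℝ => h ^ 2) ?_
      (by simpa using Asymptotics.isLittleO_pow_id (𝕜 := ℝ) (n := 2) (by norm_num))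
    refine Asymptotics.IsBigO.of_bound 1 (Filter.Eventually.of_forall fun h => ?_)
    simp only [zero_add, max_self, smul_eq_mul, mul_zero, sub_zero, one_mul, Real.norm_eq_abs,
      ne_eq, OfNat.ofNat_ne_zero, not_false_eq_true, zero_pow, zero_div]
    rw [abs_of_nonneg (by positivity), abs_of_nonneg (by positivity)]
    rcases le_total 0 h with h' | h'
    · rw [max_eq_right h']; nlinarith
    · rw [max_eq_left h']; nlinarith
  · rw [max_eq_right h.le]
    have : HasDerivAt (fun x : ℝ => x ^ 2 / 2) x x := by
      simpa using (hasDerivAt_pow 2 x).div_const 2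
    refine this.congr_of_eventuallyEq ?_
    filter_upwards [lt_mem_nhds h] with y hy
    rw [max_eq_right hy.le]

lemma integral_max_zero_sub (a b q : ℝ) :
    ∫ s in a..b, max 0 (s - q) = ((max 0 (b - q)) ^ 2 - (max 0 (a - q)) ^ 2) / 2 := by
  rw [intervalIntegral.integral_eq_sub_of_hasDerivAt
    (f := fun s => (max 0 (s - q)) ^ 2 / 2)
    (fun s _ => by simpa using (hasDerivAt_max_zero_sq (s - q)).comp_sub_const s q)
    ((by fun_prop : Continuous fun s => max 0 (s - q)).intervalIntegrable _ _)]
  ring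

lemma diagRev_max (xA xB yA yC : ℝ) (p : ℝ → ℝ) (t : ℝ) :
    diagRev xA xB yA yC (fun z => max 0 (z.2 - p (z.1 - z.2))) t
      = diagGain xA xB yA yC t (p t) := by
  simp only [diagRev, add_sub_cancel_right, integral_max_zero_sub, diagGain, gain]
  ring

lemma mem_V_iff {xA xB yA yC t s : ℝ} :
    (t + s, s) ∈ V xA xB yA yC ↔ s ∈ Icc (lowEnd xA yA t) (topEnd xB yC t) := by
  simp only [V, mem_Icc, Prod.mk_le_mk, lowEnd, topEnd, max_le_iff, le_min_iff]
  constructor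
  · rintro ⟨⟨_, _⟩, _, _⟩
    exact ⟨⟨by linarith, by linarith⟩, by linarith, by linarith⟩
  · rintro ⟨⟨_, _⟩, _, _⟩
    exact ⟨⟨by linarith, by linarith⟩, by linarith, by linarith⟩

lemma lowEnd_le_topEnd {xA xB yA yC t : ℝ} (h1 : xA ≤ xB) (h3 : yA ≤ yC)
    (ht : t ∈ Icc (xA - yC) (xB - yA)) : lowEnd xA yA t ≤ topEnd xB yC t :=
  max_le (le_min h3 (by linarith [ht.2])) (le_min (by linarith [ht.1]) (by linarith))

lemma IsUtility.diagRev_le {xA xB yA yC : ℝ} {v : ℝ × ℝ → ℝ} (hv : IsUtility v)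
    (h0 : 0 ≤ xA) (h1 : xA ≤ xB) (h2 : 0 ≤ yA) (h3 : yA ≤ yC)
    (hpos : ∀ z ∈ V xA xB yA yC, 0 ≤ v z) {t : ℝ} (ht : t ∈ Icc (xA - yC) (xB - yA)) :
    diagRev xA xB yA yC v t ≤ diagGain xA xB yA yC t (edgePrice xB yC v t) := by
  set p := edgePrice xB yC v with hp
  rw [← diagRev_max xA xB yA yC p t]
  have hle := lowEnd_le_topEnd h1 h3 ht
  have hge : ∀ s ∈ Icc (lowEnd xA yA t) (topEnd xB yC t), max 0 (s - p t) ≤ v (t + s, s) := by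
    intro s hs
    refine max_le (hpos _ (mem_V_iff.2 hs)) ?_
    have := hv.sub_le (t + topEnd xB yC t, topEnd xB yC t) (t + s, s)
    simp only [add_sub_add_left_eq_sub, max_self] at this
    rw [max_eq_right (by linarith [hs.2])] at this
    rw [hp, edgePrice]
    linarith
  have htop : max 0 (topEnd xB yC t - p t) = v (t + topEnd xB yC t, topEnd xB yC t) := by
    refine le_antisymm (hge _ ⟨hle, le_rfl⟩) ((le_of_eq ?_).trans (le_max_right _ _))
    rw [hp, edgePrice]; ring
  have hw : 0 ≤ lowWeight xA yA t := by unfold lowWeight; split_ifs <;> assumption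
  simp only [diagRev, add_sub_cancel_right, htop]
  have hmono := intervalIntegral.integral_mono_on (μ := volume) hle
    ((by fun_prop : Continuous fun s => max 0 (s - p t)).intervalIntegrable _ _)
    ((hv.lipschitz.continuous.comp (by fun_prop : Continuous fun s => (t + s, s))
      ).intervalIntegrable _ _) hge
  simp only [Function.comp_apply] at hmono
  have := mul_le_mul_of_nonneg_left (hge _ ⟨le_rfl, hle⟩) hw
  linarith

lemma LipschitzWith.integral_mul_deriv {K : NNReal} {f : ℝ → ℝ} (hf : LipschitzWith K f)
    (a b : ℝ) : ∫ x in a..b, x * deriv f x = b * f b - a * f a - ∫ x in a..b, f x := by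
  have := AbsolutelyContinuousOnInterval.integral_mul_deriv_eq_deriv_mul
    (LipschitzWith.id.lipschitzOnWith.absolutelyContinuousOnInterval (a := a) (b := b))
    (hf.lipschitzOnWith.absolutelyContinuousOnInterval (a := a) (b := b))
  simpa using this

lemma V_eq_prod (xA xB yA yC : ℝ) : V xA xB yA yC = Icc xA xB ×ˢ Icc yA yC :=
  Icc_prod_eq _ _

lemma measurableSet_V (xA xB yA yC : ℝ) : MeasurableSet (V xA xB yA yC) := measurableSet_Icc

lemma integral_V {f : ℝ × ℝ → ℝ} {xA xB yA yC : ℝ} (h1 : xA ≤ xB) (h3 : yA ≤ yC)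
    (hf : IntegrableOn f (V xA xB yA yC)) :
    ∫ z in V xA xB yA yC, f z = ∫ x in xA..xB, ∫ y in yA..yC, f (x, y) := by
  rw [V_eq_prod, Measure.volume_eq_prod] at *
  rw [setIntegral_prod _ hf, intervalIntegral.integral_of_le h1, integral_Icc_eq_integral_Ioc]
  simp only [intervalIntegral.integral_of_le h3, integral_Icc_eq_integral_Ioc]

lemma integrableOn_V_of_continuous {f : ℝ × ℝ → ℝ} (hf : Continuous f) (xA xB yA yC : ℝ) :
    IntegrableOn f (V xA xB yA yC) :=
  hf.continuousOn.integrableOn_compact isCompact_Icc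

lemma LipschitzWith.integrableOn_mul_fderiv {v : ℝ × ℝ → ℝ} (hv : LipschitzWith 1 v)
    {g : ℝ × ℝ → ℝ} (hg : Continuous g) (e : ℝ × ℝ) (xA xB yA yC : ℝ) :
    IntegrableOn (fun z => g z * fderiv ℝ v z e) (V xA xB yA yC) := by
  refine (integrableOn_V_of_continuous hg xA xB yA yC).mul_bdd (c := ‖e‖)
    (measurable_fderiv_apply_const ℝ v e).aestronglyMeasurable
    (Filter.Eventually.of_forall fun z => ?_)
  refine (ContinuousLinearMap.le_opNorm _ _).trans ?_
  have := norm_fderiv_le_of_lipschitz ℝ (x₀ := z) hv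
  simpa using mul_le_mul_of_nonneg_right this (norm_nonneg e)

lemma LipschitzWith.integral_mul_pd2 {v : ℝ × ℝ → ℝ} (hv : LipschitzWith 1 v)
    {xA xB yA yC : ℝ} (h1 : xA ≤ xB) (h3 : yA ≤ yC) :
    ∫ z in V xA xB yA yC, z.2 * pd2 v z
      = yC * (∫ x in xA..xB, v (x, yC)) - yA * (∫ x in xA..xB, v (x, yA))
        - ∫ z in V xA xB yA yC, v z := by
  have hc := hv.continuous
  have hi : IntegrableOn (fun z => z.2 * pd2 v z) (V xA xB yA yC) :=
    hv.integrableOn_mul_fderiv continuous_snd _ _ _ _ _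
  rw [integral_V h1 h3 hi,
    integral_V h1 h3 (integrableOn_V_of_continuous hc _ _ _ _)]
  have hd : ∀ᵐ z : ℝ × ℝ ∂(volume.prod volume), DifferentiableAt ℝ v z := by
    rw [← Measure.volume_eq_prod]; exact hv.ae_differentiableAt
  have key : ∀ᵐ x : ℝ, ∫ y in yA..yC, (x, y).2 * pd2 v (x, y)
      = yC * v (x, yC) - yA * v (x, yA) - ∫ y in yA..yC, v (x, y) := by
    filter_upwards [Measure.ae_ae_of_ae_prod hd] with x hx
    have hl : LipschitzWith (1 * 1) (fun y => v (x, y)) := hv.comp (LipschitzWith.prodMk_left x)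
    rw [← hl.integral_mul_deriv]
    refine intervalIntegral.integral_congr_ae ?_
    filter_upwards [hx] with y hy _
    have : HasDerivAt (fun y : ℝ => v (x, y)) (fderiv ℝ v (x, y) (0, 1)) y :=
      hy.hasFDerivAt.comp_hasDerivAt y ((hasDerivAt_const y x).prodMk (hasDerivAt_id y))
    rw [this.deriv, pd2]
  rw [intervalIntegral.integral_congr_ae (key.mono fun x hx _ => hx)]
  have hi := intervalIntegral.continuous_parametric_intervalIntegral_of_continuous' (μ := volume)
    (f := fun x y => v (x, y)) (by exact hc) yA yC
  rw [intervalIntegral.integral_sub, intervalIntegral.integral_sub,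
    intervalIntegral.integral_const_mul, intervalIntegral.integral_const_mul]
  · exact (by fun_prop : Continuous fun x => yC * v (x, yC)).intervalIntegrable _ _
  · exact (by fun_prop : Continuous fun x => yA * v (x, yA)).intervalIntegrable _ _
  · exact (by fun_prop : Continuous fun x => yC * v (x, yC) - yA * v (x, yA)).intervalIntegrable _ _
  · exact hi.intervalIntegrable _ _

lemma integral_V_swap (f : ℝ × ℝ → ℝ) (xA xB yA yC : ℝ) :
    ∫ z in V yA yC xA xB, f z.swap = ∫ z in V xA xB yA yC, f z := by
  simp only [V_eq_prod, Measure.volume_eq_prod]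
  exact setIntegral_prod_swap _ _ _

lemma pd2_comp_swap (v : ℝ × ℝ → ℝ) (z : ℝ × ℝ) :
    pd2 (fun z => v z.swap) z = pd1 v z.swap := by
  have := (ContinuousLinearEquiv.prodComm ℝ ℝ ℝ).comp_right_fderiv (f := v) (x := z)
  have h2 := congrArg (fun L => L (0, 1)) this
  simpa [Function.comp_def, pd2, pd1] using h2

lemma LipschitzWith.integral_mul_pd1 {v : ℝ × ℝ → ℝ} (hv : LipschitzWith 1 v)
    {xA xB yA yC : ℝ} (h1 : xA ≤ xB) (h3 : yA ≤ yC) :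
    ∫ z in V xA xB yA yC, z.1 * pd1 v z
      = xB * (∫ y in yA..yC, v (xB, y)) - xA * (∫ y in yA..yC, v (xA, y))
        - ∫ z in V xA xB yA yC, v z := by
  have hs : LipschitzWith 1 (fun z : ℝ × ℝ => v z.swap) := by
    refine LipschitzWith.of_dist_le_mul fun z w => ?_
    refine (hv.dist_le_mul _ _).trans_eq ?_
    simp [Prod.dist_eq, max_comm]
  rw [← integral_V_swap, ← integral_V_swap v]
  simpa [pd2_comp_swap] using hs.integral_mul_pd2 h3 h1

lemma Rev_uniform {v : ℝ × ℝ → ℝ} (hv : LipschitzWith 1 v) {xA xB yA yC : ℝ} (h1 : xA ≤ xB)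
    (h3 : yA ≤ yC) (a b : ℝ) :
    Rev xA xB yA yC (fun _ => a) (fun _ => b) v
      = (xB * (∫ y in yA..yC, v (xB, y)) - xA * (∫ y in yA..yC, v (xA, y))
        + yC * (∫ x in xA..xB, v (x, yC)) - yA * (∫ x in xA..xB, v (x, yA))
        - 3 * ∫ z in V xA xB yA yC, v z) * (a * b) := by
  have i1 : IntegrableOn (fun z => z.1 * pd1 v z) (V xA xB yA yC) :=
    hv.integrableOn_mul_fderiv continuous_fst _ _ _ _ _
  have i2 : IntegrableOn (fun z => z.2 * pd2 v z) (V xA xB yA yC) :=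
    hv.integrableOn_mul_fderiv continuous_snd _ _ _ _ _
  have i3 := integrableOn_V_of_continuous hv.continuous xA xB yA yC
  have i12 : IntegrableOn (fun z => z.1 * pd1 v z + z.2 * pd2 v z) (V xA xB yA yC) := i1.add i2
  rw [Rev, integral_mul_const, integral_sub i12 i3, integral_add i1 i2,
    hv.integral_mul_pd1 h1 h3, hv.integral_mul_pd2 h1 h3]
  ring

lemma integral_of_eqOn_Ioo {f A B : ℝ → ℝ} {m d M : ℝ} (hA : Continuous A) (hB : Continuous B)
    (hmd : m ≤ d) (hdM : d ≤ M) (h1 : EqOn A f (Ioo m d)) (h2 : EqOn B f (Ioo d M)) :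
    IntervalIntegrable f volume m M ∧
      ∫ t in m..M, f t = (∫ t in m..d, A t) + ∫ t in d..M, B t := by
  have i1 : IntervalIntegrable f volume m d :=
    (hA.intervalIntegrable m d).congr_uIoo (by rwa [uIoo_of_le hmd])
  have i2 : IntervalIntegrable f volume d M :=
    (hB.intervalIntegrable d M).congr_uIoo (by rwa [uIoo_of_le hdM])
  refine ⟨i1.trans i2, ?_⟩
  rw [← intervalIntegral.integral_add_adjacent_intervals i1 i2,
    intervalIntegral.integral_congr_Ioo_of_le hmd h1,
    intervalIntegral.integral_congr_Ioo_of_le hdM h2]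

@[fun_prop]
lemma continuous_topEnd (xB yC : ℝ) : Continuous (topEnd xB yC) := by unfold topEnd; fun_prop

@[fun_prop]
lemma continuous_lowEnd (xA yA : ℝ) : Continuous (lowEnd xA yA) := by unfold lowEnd; fun_prop

lemma integral_topWeight {v : ℝ × ℝ → ℝ} (hv : Continuous v) {xA xB yA yC : ℝ} (h1 : xA ≤ xB)
    (h3 : yA ≤ yC) :
    IntervalIntegrable (fun t => topWeight xB yC t * v (t + topEnd xB yC t, topEnd xB yC t))
        volume (xA - yC) (xB - yA) ∧
      ∫ t in (xA - yC)..(xB - yA), topWeight xB yC t * v (t + topEnd xB yC t, topEnd xB yC t)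
        = yC * (∫ x in xA..xB, v (x, yC)) + xB * ∫ y in yA..yC, v (xB, y) := by
  have := integral_of_eqOn_Ioo (m := xA - yC) (d := xB - yC) (M := xB - yA)
    (f := fun t => topWeight xB yC t * v (t + topEnd xB yC t, topEnd xB yC t))
    (A := fun t => yC * v (t + yC, yC)) (B := fun t => xB * v (xB, xB - t))
    (by fun_prop) (by fun_prop) (by linarith) (by linarith)
    (fun t ht => by
      have h : t < xB - yC := ht.2
      simp only [topWeight, if_pos h, topEnd, min_eq_left (show yC ≤ xB - t by linarith)])
    (fun t ht => by
      have h : xB - yC < t := ht.1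
      simp only [topWeight, if_neg h.not_gt, topEnd, min_eq_right (show xB - t ≤ yC by linarith),
        add_sub_cancel])
  refine ⟨this.1, this.2.trans ?_⟩
  rw [intervalIntegral.integral_const_mul, intervalIntegral.integral_const_mul,
    intervalIntegral.integral_comp_add_right (fun x => v (x, yC)),
    intervalIntegral.integral_comp_sub_left (fun y => v (xB, y))]
  simp

lemma integral_lowWeight {v : ℝ × ℝ → ℝ} (hv : Continuous v) {xA xB yA yC : ℝ} (h1 : xA ≤ xB)
    (h3 : yA ≤ yC) :
    IntervalIntegrable (fun t => lowWeight xA yA t * v (t + lowEnd xA yA t, lowEnd xA yA t))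
        volume (xA - yC) (xB - yA) ∧
      ∫ t in (xA - yC)..(xB - yA), lowWeight xA yA t * v (t + lowEnd xA yA t, lowEnd xA yA t)
        = xA * (∫ y in yA..yC, v (xA, y)) + yA * ∫ x in xA..xB, v (x, yA) := by
  have := integral_of_eqOn_Ioo (m := xA - yC) (d := xA - yA) (M := xB - yA)
    (f := fun t => lowWeight xA yA t * v (t + lowEnd xA yA t, lowEnd xA yA t))
    (A := fun t => xA * v (xA, xA - t)) (B := fun t => yA * v (t + yA, yA))
    (by fun_prop) (by fun_prop) (by linarith) (by linarith)
    (fun t ht => by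
      have h : t < xA - yA := ht.2
      simp only [lowWeight, if_pos h, lowEnd, max_eq_right (show yA ≤ xA - t by linarith),
        add_sub_cancel])
    (fun t ht => by
      have h : xA - yA < t := ht.1
      simp only [lowWeight, if_neg h.not_gt, lowEnd, max_eq_left (show xA - t ≤ yA by linarith)])
  refine ⟨this.1, this.2.trans ?_⟩
  rw [intervalIntegral.integral_const_mul, intervalIntegral.integral_const_mul,
    intervalIntegral.integral_comp_add_right (fun x => v (x, yA)),
    intervalIntegral.integral_comp_sub_left (fun y => v (xA, y))]
  simp

lemma continuous_integral_diag {v : ℝ × ℝ → ℝ} (hv : Continuous v) (xA xB yA yC : ℝ) :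
    Continuous fun t => ∫ s in (lowEnd xA yA t)..(topEnd xB yC t), v (t + s, s) := by
  have hc : Continuous (Function.uncurry fun t s => v (t + s, s)) := by fun_prop
  have hi : ∀ t a b, IntervalIntegrable (fun s => v (t + s, s)) volume a b := fun t a b =>
    (by fun_prop : Continuous fun s => v (t + s, s)).intervalIntegrable a b
  have h := (intervalIntegral.continuous_parametric_intervalIntegral_of_continuous
    (μ := volume) (a₀ := 0) hc (continuous_topEnd xB yC)).sub
    (intervalIntegral.continuous_parametric_intervalIntegral_of_continuous
    (μ := volume) (a₀ := 0) hc (continuous_lowEnd xA yA))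
  refine h.congr fun t => ?_
  exact intervalIntegral.integral_interval_sub_left (hi _ _ _) (hi _ _ _)

lemma integral_V_diag {v : ℝ × ℝ → ℝ} (hv : Continuous v) {xA xB yA yC : ℝ} (h1 : xA ≤ xB)
    (h3 : yA ≤ yC) :
    ∫ z in V xA xB yA yC, v z = ∫ t in (xA - yC)..(xB - yA),
      ∫ s in (lowEnd xA yA t)..(topEnd xB yC t), v (t + s, s) := by
  set F := (V xA xB yA yC).indicator v with hF
  have hV := measurableSet_V xA xB yA yC
  have hFi : Integrable F (volume.prod volume) := by
    rw [← Measure.volume_eq_prod]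
    exact (integrableOn_V_of_continuous hv _ _ _ _).integrable_indicator hV
  have mp := measurePreserving_add_prod (volume : Measure ℝ) (volume : Measure ℝ)
  have hGi : Integrable (fun z : ℝ × ℝ => F (z.1 + z.2, z.2)) (volume.prod volume) :=
    mp.integrable_comp_of_integrable hFi
  have e1 : ∫ z, F z = ∫ z : ℝ × ℝ, F (z.1 + z.2, z.2) ∂(volume.prod volume) := by
    rw [Measure.volume_eq_prod, ← integral_map mp.measurable.aemeasurable (by
      rw [mp.map_eq]; exact hFi.aestronglyMeasurable), mp.map_eq]
  have inner : ∀ t, ∫ s, F (t + s, s) = ∫ s in Icc (lowEnd xA yA t) (topEnd xB yC t),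
      v (t + s, s) := fun t => by
    rw [← integral_indicator measurableSet_Icc]
    congr 1
    ext s
    simp only [hF, indicator, mem_V_iff]
  rw [← integral_indicator hV, ← hF, e1, integral_prod _ hGi]
  simp only [inner]
  rw [intervalIntegral.integral_of_le (by linarith), ← integral_Icc_eq_integral_Ioc,
    ← integral_indicator measurableSet_Icc]
  congr 1
  ext t
  by_cases ht : t ∈ Icc (xA - yC) (xB - yA)
  · rw [indicator_of_mem ht, intervalIntegral.integral_of_le (lowEnd_le_topEnd h1 h3 ht),
      integral_Icc_eq_integral_Ioc]
  · rw [indicator_of_notMem ht, Icc_eq_empty, setIntegral_empty]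
    intro h
    have a1 : yA ≤ xB - t := (le_max_left _ _).trans (h.trans (min_le_right _ _))
    have a2 : xA - t ≤ yC := (le_max_right _ _).trans (h.trans (min_le_left _ _))
    exact ht ⟨by linarith, by linarith⟩

lemma intervalIntegrable_diagRev {v : ℝ × ℝ → ℝ} (hv : Continuous v) {xA xB yA yC : ℝ}
    (h1 : xA ≤ xB) (h3 : yA ≤ yC) :
    IntervalIntegrable (diagRev xA xB yA yC v) volume (xA - yC) (xB - yA) :=
  ((integral_topWeight hv h1 h3).1.sub (integral_lowWeight hv h1 h3).1).sub
    (((continuous_integral_diag hv xA xB yA yC).const_mul 3).intervalIntegrable _ _)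

lemma Rev_eq_integral_diagRev {v : ℝ × ℝ → ℝ} (hv : LipschitzWith 1 v) {xA xB yA yC : ℝ}
    (h1 : xA ≤ xB) (h3 : yA ≤ yC) (a b : ℝ) :
    Rev xA xB yA yC (fun _ => a) (fun _ => b) v
      = (∫ t in (xA - yC)..(xB - yA), diagRev xA xB yA yC v t) * (a * b) := by
  have hc := hv.continuous
  obtain ⟨i1, e1⟩ := integral_topWeight hc h1 h3
  obtain ⟨i2, e2⟩ := integral_lowWeight hc h1 h3
  have i3 := ((continuous_integral_diag hc xA xB yA yC).const_mul 3).intervalIntegrable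
    (μ := volume) (xA - yC) (xB - yA)
  rw [Rev_uniform hv h1 h3]
  simp only [diagRev]
  rw [intervalIntegral.integral_sub (i1.sub i2) i3, intervalIntegral.integral_sub i1 i2, e1, e2,
    intervalIntegral.integral_const_mul, ← integral_V_diag hc h1 h3]
  ring

lemma ConvexOn.add_fderiv_le {E : Type*} [NormedAddCommGroup E] [NormedSpace ℝ E] {S : Set E}
    {u : E → ℝ} (hu : ConvexOn ℝ S u) {w z : E} (hw : w ∈ S) (hz : z ∈ S)
    (hd : DifferentiableAt ℝ u w) : u w + fderiv ℝ u w (z - w) ≤ u z := by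
  have hc := hu.comp_affineMap (AffineMap.lineMap w z : ℝ →ᵃ[ℝ] E)
  have hder : HasDerivAt (u ∘ (AffineMap.lineMap w z : ℝ →ᵃ[ℝ] E)) (fderiv ℝ u w (z - w)) 0 := by
    refine HasFDerivAt.comp_hasDerivAt (0 : ℝ) ?_ AffineMap.hasDerivAt_lineMap
    rw [AffineMap.lineMap_apply_zero]
    exact hd.hasFDerivAt
  have := hc.le_slope_of_hasDerivAt (x := 0) (y := 1) (by simpa using hw) (by simpa using hz)
    one_pos hder
  simp [slope_def_field] at this
  rw [map_sub]
  linarith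

lemma ConvexOn.dense_differentiableAt_interior {E : Type*} [NormedAddCommGroup E]
    [NormedSpace ℝ E] [FiniteDimensional ℝ E] {S : Set E} {u : E → ℝ} (hu : ConvexOn ℝ S u) :
    interior S ⊆ closure {w | w ∈ interior S ∧ DifferentiableAt ℝ u w} := by
  borelize E
  intro z hz
  obtain ⟨K, t, ht, hK⟩ := hu.locallyLipschitzOn_interior hz
  rw [isOpen_interior.nhdsWithin_eq hz] at ht
  have hdense := Measure.dense_of_ae
    (hK.ae_differentiableWithinAt_of_mem (μ := Measure.addHaar))
  refine mem_closure_iff.2 fun O hO hzO => ?_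
  obtain ⟨w, ⟨⟨hwO, hwS⟩, hwt⟩, hw⟩ := hdense.inter_open_nonempty
    (O ∩ interior S ∩ interior t) ((hO.inter isOpen_interior).inter isOpen_interior)
    ⟨z, ⟨hzO, hz⟩, mem_interior_iff_mem_nhds.2 ht⟩
  exact ⟨w, hwO, hwS, (hw (interior_subset hwt)).differentiableAt
    (mem_interior_iff_mem_nhds.1 hwt)⟩

lemma interior_V (xA xB yA yC : ℝ) : interior (V xA xB yA yC) = Ioo xA xB ×ˢ Ioo yA yC := by
  rw [V_eq_prod, interior_prod_eq, interior_Icc, interior_Icc]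

lemma interior_V_ae_eq (xA xB yA yC : ℝ) :
    interior (V xA xB yA yC) =ᵐ[volume] V xA xB yA yC :=
  interior_ae_eq_of_null_frontier ((convex_Icc _ _).addHaar_frontier _)

lemma Rev_congr_interior {xA xB yA yC : ℝ} {f1 f2 : ℝ → ℝ} {u v : ℝ × ℝ → ℝ}
    (h : EqOn u v (interior (V xA xB yA yC))) :
    Rev xA xB yA yC f1 f2 u = Rev xA xB yA yC f1 f2 v := by
  simp only [Rev, ← setIntegral_congr_set (interior_V_ae_eq xA xB yA yC)]
  refine setIntegral_congr_fun isOpen_interior.measurableSet fun z hz => ?_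
  have : fderiv ℝ u z = fderiv ℝ v z :=
    (h.eventuallyEq_of_mem (isOpen_interior.mem_nhds hz)).fderiv_eq
  simp only [pd1, pd2, this, h hz]

lemma LipschitzWith.integrableOn_Rev {v : ℝ × ℝ → ℝ} (hv : LipschitzWith 1 v)
    (xA xB yA yC k : ℝ) :
    IntegrableOn (fun z => (z.1 * pd1 v z + z.2 * pd2 v z - v z) * k) (V xA xB yA yC) :=
  (((hv.integrableOn_mul_fderiv continuous_fst _ _ _ _ _).add
    (hv.integrableOn_mul_fderiv continuous_snd _ _ _ _ _)).sub
    (integrableOn_V_of_continuous hv.continuous _ _ _ _)).mul_const k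

lemma IsUtility.sub_const {v : ℝ × ℝ → ℝ} (hv : IsUtility v) (k : ℝ) :
    IsUtility (fun z => v z - k) := by
  refine ⟨fun z w => by simpa using hv.sub_le z w, convex_univ, fun x hx y hy a b ha hb hab => ?_⟩
  have := hv.convex.2 hx hy ha hb hab
  simp only [smul_eq_mul] at this ⊢
  obtain rfl : b = 1 - a := by linarith
  linarith

lemma IsUtility.Rev_le_Rev_sub_const {v : ℝ × ℝ → ℝ} (hv : IsUtility v) {k : ℝ} (hk : 0 ≤ k)
    (xA xB yA yC : ℝ) {a b : ℝ} (ha : 0 ≤ a) (hb : 0 ≤ b) :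
    Rev xA xB yA yC (fun _ => a) (fun _ => b) v
      ≤ Rev xA xB yA yC (fun _ => a) (fun _ => b) (fun z => v z - k) := by
  refine integral_mono (hv.lipschitz.integrableOn_Rev xA xB yA yC (a * b))
    ((hv.sub_const k).lipschitz.integrableOn_Rev xA xB yA yC (a * b)) fun z => ?_
  refine mul_le_mul_of_nonneg_right ?_ (mul_nonneg ha hb)
  simp only [pd1, pd2, fderiv_sub_const]
  linarith

lemma linear_le_max {L : ℝ × ℝ →L[ℝ] ℝ} (h1 : 0 ≤ L (1, 0)) (h2 : 0 ≤ L (0, 1))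
    (h3 : L (1, 0) + L (0, 1) ≤ 1) (d : ℝ × ℝ) : L d ≤ max 0 (max d.1 d.2) := by
  have e : L d = d.1 * L (1, 0) + d.2 * L (0, 1) := by
    conv_lhs => rw [show d = d.1 • ((1 : ℝ), (0 : ℝ)) + d.2 • ((0 : ℝ), (1 : ℝ)) by ext <;> simp]
    rw [map_add, map_smul, map_smul, smul_eq_mul, smul_eq_mul]
  have a1 : d.1 ≤ max 0 (max d.1 d.2) := (le_max_left _ _).trans (le_max_right _ _)
  have a2 : d.2 ≤ max 0 (max d.1 d.2) := (le_max_right _ _).trans (le_max_right _ _)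
  have a0 : 0 ≤ max 0 (max d.1 d.2) := le_max_left _ _
  rw [e]
  nlinarith

lemma isUtility_iSup {ι : Type*} [Nonempty ι] {L : ι → ℝ × ℝ →L[ℝ] ℝ} {k : ι → ℝ}
    (hL : ∀ i d, L i d ≤ max 0 (max d.1 d.2))
    (hb : ∀ z, BddAbove (range fun i => L i z + k i)) :
    IsUtility (fun z => ⨆ i, (L i z + k i)) := by
  refine ⟨fun z w => ?_, convex_univ, fun z _ w _ a b ha hb' hab => ?_⟩
  · rw [sub_le_iff_le_add]
    refine ciSup_le fun i => ?_
    have h1 := hL i (z - w)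
    have h2 := le_ciSup (hb w) i
    simp only [map_sub, Prod.fst_sub, Prod.snd_sub] at h1 h2
    linarith
  · refine ciSup_le fun i => ?_
    have h1 := mul_le_mul_of_nonneg_left (le_ciSup (hb z) i) ha
    have h2 := mul_le_mul_of_nonneg_left (le_ciSup (hb w) i) hb'
    simp only [map_add, map_smul, smul_eq_mul] at h1 h2 ⊢
    obtain rfl : b = 1 - a := by linarith
    linarith

lemma UDFeasible.exists_isUtility_eqOn {xA xB yA yC : ℝ} (h1 : xA < xB) (h3 : yA < yC)
    {u : ℝ × ℝ → ℝ} (hu : UDFeasible xA xB yA yC u) :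
    ∃ v, IsUtility v ∧ EqOn u v (interior (V xA xB yA yC)) := by
  obtain ⟨-, hconv, hgrad⟩ := hu
  set I := interior (V xA xB yA yC) with hI
  obtain ⟨z₀, hz₀⟩ : I.Nonempty := by
    rw [hI, interior_V]; exact (nonempty_Ioo.2 h1).prod (nonempty_Ioo.2 h3)
  set D := {w | w ∈ I ∧ DifferentiableAt ℝ u w} with hD
  have hdense : I ⊆ closure D := hconv.dense_differentiableAt_interior
  have : Nonempty D := (closure_nonempty_iff.1 ⟨z₀, hdense hz₀⟩).to_subtype
  have hL : ∀ (w : D) d, fderiv ℝ u w d ≤ max 0 (max d.1 d.2) := fun w d => by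
    obtain ⟨a, b, c⟩ := hgrad w (interior_subset w.2.1) w.2.2
    exact linear_le_max a b c d
  have hle : ∀ (w : D), ∀ z ∈ I, fderiv ℝ u w z + (u w - fderiv ℝ u w w) ≤ u z := fun w z hz => by
    have := hconv.add_fderiv_le (interior_subset w.2.1) (interior_subset hz) w.2.2
    rw [map_sub] at this
    linarith
  have hb : ∀ z, BddAbove (range fun w : D => fderiv ℝ u w z + (u w - fderiv ℝ u w w)) := by
    refine fun z => ⟨u z₀ + max 0 (max (z - z₀).1 (z - z₀).2), ?_⟩
    rintro _ ⟨w, rfl⟩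
    have a := hL w (z - z₀)
    have b := hle w z₀ hz₀
    rw [map_sub] at a
    simp only
    linarith
  have hv := isUtility_iSup hL hb
  refine ⟨_, hv, ?_⟩
  intro z hz
  have : (nhdsWithin z D).NeBot := mem_closure_iff_nhdsWithin_neBot.1 (hdense hz)
  have hcont : ContinuousAt u z :=
    (hconv.locallyLipschitzOn_interior.continuousOn).continuousAt (isOpen_interior.mem_nhds hz)
  refine tendsto_nhds_unique_of_eventuallyEq (l := nhdsWithin z D)
    (hcont.tendsto.mono_left nhdsWithin_le_nhds)
    ((hv.lipschitz.continuous.tendsto z).mono_left nhdsWithin_le_nhds) ?_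
  filter_upwards [self_mem_nhdsWithin] with w hw
  refine le_antisymm ?_ (ciSup_le fun i => hle i w hw.1)
  have := le_ciSup (hb w) ⟨w, hw⟩
  simpa using this

lemma UDFeasible.exists_isUtility {xA xB yA yC : ℝ} (h1 : xA < xB) (h3 : yA < yC)
    {u : ℝ × ℝ → ℝ} (hu : UDFeasible xA xB yA yC u) {a b : ℝ} (ha : 0 ≤ a) (hb : 0 ≤ b) :
    ∃ v, IsUtility v ∧ v (xA, yA) = 0 ∧ Rev xA xB yA yC (fun _ => a) (fun _ => b) u
      ≤ Rev xA xB yA yC (fun _ => a) (fun _ => b) v := by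
  obtain ⟨v, hv, huv⟩ := hu.exists_isUtility_eqOn h1 h3
  have hA : 0 ≤ v (xA, yA) := by
    have hmem : (xA, yA) ∈ closure (interior (V xA xB yA yC)) := by
      rw [interior_V, closure_prod_eq, closure_Ioo h1.ne, closure_Ioo h3.ne]
      exact ⟨left_mem_Icc.2 h1.le, left_mem_Icc.2 h3.le⟩
    refine closure_minimal (fun z hz => ?_) (isClosed_Ici.preimage hv.lipschitz.continuous) hmem
    rw [mem_preimage, mem_Ici, ← huv hz]
    exact hu.1 z (interior_subset hz)
  refine ⟨_, hv.sub_const (v (xA, yA)), sub_self _, ?_⟩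
  rw [Rev_congr_interior huv]
  exact hv.Rev_le_Rev_sub_const hA xA xB yA yC ha hb

lemma IsUtility.udFeasible {v : ℝ × ℝ → ℝ} (hv : IsUtility v) {xA xB yA yC : ℝ}
    (hpos : ∀ z ∈ V xA xB yA yC, 0 ≤ v z) : UDFeasible xA xB yA yC v := by
  refine ⟨hpos, hv.convex.subset (subset_univ _) (convex_Icc _ _), fun z _ hz => ?_⟩
  have key : ∀ d, fderiv ℝ v z d ≤ max 0 (max d.1 d.2) := fun d => by
    have h1 := hv.convex.add_fderiv_le (mem_univ z) (mem_univ (z + d)) hz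
    have h2 := hv.sub_le (z + d) z
    simp only [add_sub_cancel_left, Prod.fst_add, Prod.snd_add] at h1 h2
    linarith
  have a := key (-(1, 0))
  have b := key (-(0, 1))
  have c := key ((1, 0) + (0, 1))
  rw [map_neg] at a b
  rw [map_add] at c
  norm_num at a b c
  exact ⟨a, b, c⟩

lemma IsUtility.nonneg_of_mem_V {v : ℝ × ℝ → ℝ} (hv : IsUtility v) {xA xB yA yC : ℝ}
    (hA : v (xA, yA) = 0) : ∀ z ∈ V xA xB yA yC, 0 ≤ v z := by
  intro z hz
  have h := hv.sub_le (xA, yA) z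
  have h1 : xA ≤ z.1 := hz.1.1
  have h2 : yA ≤ z.2 := hz.1.2
  rw [max_eq_left (max_le (by simpa using h1) (by simpa using h2)), hA] at h
  linarith

/-- The utility of the menu offering, besides `(0, 0, 0)`, the items
`(-s i, 1 + s i, c i)`. -/
def menuUtility (s c : Fin 4 → ℝ) (z : ℝ × ℝ) : ℝ := max 0 (z.2 - minLine s c (z.1 - z.2))

lemma minLine_le (s c : Fin 4 → ℝ) (t : ℝ) (i : Fin 4) : minLine s c t ≤ c i + s i * t := by
  unfold minLine
  fin_cases i <;> simp

lemma exists_minLine_eq (s c : Fin 4 → ℝ) (t : ℝ) : ∃ i, minLine s c t = c i + s i * t := by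
  unfold minLine
  rcases min_choice (min (c 0 + s 0 * t) (c 1 + s 1 * t)) (min (c 2 + s 2 * t) (c 3 + s 3 * t))
    with h | h <;> rw [h]
  · rcases min_choice (c 0 + s 0 * t) (c 1 + s 1 * t) with h | h <;> exact ⟨_, h⟩
  · rcases min_choice (c 2 + s 2 * t) (c 3 + s 3 * t) with h | h <;> exact ⟨_, h⟩

lemma iSup_menu (s c : Fin 4 → ℝ) (z : ℝ × ℝ) :
    ⨆ i : Fin 5, ((Fin.cons 0 (fun i => -s i) : Fin 5 → ℝ) i * z.1
      + (Fin.cons 0 (fun i => 1 + s i) : Fin 5 → ℝ) i * z.2 - (Fin.cons 0 c : Fin 5 → ℝ) i)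
      = menuUtility s c z := by
  have hbdd := fun f : Fin 5 → ℝ => (finite_range f).bddAbove
  refine le_antisymm (ciSup_le fun i => ?_) (max_le ?_ ?_)
  · refine Fin.cases ?_ (fun i => ?_) i
    · simp [menuUtility]
    · refine le_trans ?_ (le_max_right _ _)
      have := minLine_le s c (z.1 - z.2) i
      simp only [Fin.cons_succ]
      linarith
  · exact (by simp : (0 : ℝ) ≤ _).trans (le_ciSup (hbdd _) 0)
  · obtain ⟨i, hi⟩ := exists_minLine_eq s c (z.1 - z.2)
    refine le_trans (le_of_eq ?_) (le_ciSup (hbdd _) i.succ)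
    simp only [hi, Fin.cons_succ]
    ring

lemma isUtility_menuUtility {s : Fin 4 → ℝ} (c : Fin 4 → ℝ) (hs : ∀ i, -1 ≤ s i ∧ s i ≤ 0) :
    IsUtility (menuUtility s c) := by
  have := isUtility_iSup (ι := Fin 5)
    (L := fun i => (Fin.cons 0 (fun i => -s i) : Fin 5 → ℝ) i • ContinuousLinearMap.fst ℝ ℝ ℝ
      + (Fin.cons 0 (fun i => 1 + s i) : Fin 5 → ℝ) i • ContinuousLinearMap.snd ℝ ℝ ℝ)
    (k := fun i => -(Fin.cons 0 c : Fin 5 → ℝ) i) ?_ (fun z => (finite_range _).bddAbove)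
  · convert this using 2 with z
    rw [← iSup_menu]
    simp [sub_eq_add_neg]
  · intro i d
    refine Fin.cases ?_ (fun i => ?_) i
    · simp
    · refine linear_le_max ?_ ?_ ?_ d
      · simpa using (hs i).2
      · simpa using by linarith [(hs i).1]
      · simp

lemma continuous_menuUtility :
    Continuous fun a : ((Fin 4 → ℝ) × (Fin 4 → ℝ)) × (ℝ × ℝ) => menuUtility a.1.1 a.1.2 a.2 := by
  unfold menuUtility minLine
  fun_prop

lemma continuousOn_Rev_menuUtility {xA xB yA yC : ℝ} (h1 : xA ≤ xB) (h3 : yA ≤ yC) (a b : ℝ) :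
    ContinuousOn (fun r : (Fin 4 → ℝ) × (Fin 4 → ℝ) =>
      Rev xA xB yA yC (fun _ => a) (fun _ => b) (menuUtility r.1 r.2))
      {r | ∀ i, -1 ≤ r.1 i ∧ r.1 i ≤ 0} := by
  have hc := continuous_menuUtility
  have hx : ∀ y, Continuous fun r : (Fin 4 → ℝ) × (Fin 4 → ℝ) =>
      ∫ x in xA..xB, menuUtility r.1 r.2 (x, y) := fun y =>
    intervalIntegral.continuous_parametric_intervalIntegral_of_continuous'
      (f := fun (r : (Fin 4 → ℝ) × (Fin 4 → ℝ)) x => menuUtility r.1 r.2 (x, y))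
      (hc.comp (by fun_prop : Continuous fun q : ((Fin 4 → ℝ) × (Fin 4 → ℝ)) × ℝ =>
        (q.1, (q.2, y)))) _ _
  have hy : ∀ x, Continuous fun r : (Fin 4 → ℝ) × (Fin 4 → ℝ) =>
      ∫ y in yA..yC, menuUtility r.1 r.2 (x, y) := fun x =>
    intervalIntegral.continuous_parametric_intervalIntegral_of_continuous'
      (f := fun (r : (Fin 4 → ℝ) × (Fin 4 → ℝ)) y => menuUtility r.1 r.2 (x, y))
      (hc.comp (by fun_prop : Continuous fun q : ((Fin 4 → ℝ) × (Fin 4 → ℝ)) × ℝ =>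
        (q.1, (x, q.2)))) _ _
  have hxy : Continuous fun r : (Fin 4 → ℝ) × (Fin 4 → ℝ) =>
      ∫ x in xA..xB, ∫ y in yA..yC, menuUtility r.1 r.2 (x, y) :=
    intervalIntegral.continuous_parametric_intervalIntegral_of_continuous'
      (intervalIntegral.continuous_parametric_intervalIntegral_of_continuous'
        (f := fun (q : ((Fin 4 → ℝ) × (Fin 4 → ℝ)) × ℝ) y => menuUtility q.1.1 q.1.2 (q.2, y))
        (hc.comp (by fun_prop : Continuous
          fun q : (((Fin 4 → ℝ) × (Fin 4 → ℝ)) × ℝ) × ℝ => (q.1.1, (q.1.2, q.2)))) _ _) _ _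
  refine Continuous.continuousOn (((((((hy xB).const_mul xB).sub ((hy xA).const_mul xA)).add
    ((hx yC).const_mul yC)).sub ((hx yA).const_mul yA)).sub (hxy.const_mul 3)).mul_const (a * b))
    |>.congr fun r hr => ?_
  have hr' := (isUtility_menuUtility r.2 hr).lipschitz
  simp only [Rev_uniform hr' h1 h3]
  rw [integral_V h1 h3 (integrableOn_V_of_continuous hr'.continuous _ _ _ _)]
  rfl

lemma IsUtility.abs_edgePrice_le {xA xB yA yC : ℝ} (h0 : 0 ≤ xA) (h1 : xA ≤ xB) (h2 : 0 ≤ yA)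
    (h3 : yA ≤ yC) {v : ℝ × ℝ → ℝ} (hv : IsUtility v) (hA : v (xA, yA) = 0) {e : ℝ}
    (he : e ∈ Icc (xA - yC) (xB - yA)) : |edgePrice xB yC v e| ≤ xB + yC := by
  have hle := lowEnd_le_topEnd h1 h3 he
  have hmem : (e + topEnd xB yC e, topEnd xB yC e) ∈ V xA xB yA yC := mem_V_iff.2 ⟨hle, le_rfl⟩
  have hpos := hv.nonneg_of_mem_V hA _ hmem
  have hup := hv.sub_le (e + topEnd xB yC e, topEnd xB yC e) (xA, yA)
  obtain ⟨⟨b1, b2⟩, b3, b4⟩ := hmem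
  simp only at b1 b2 b3 b4 hup
  have hN : max 0 (max (e + topEnd xB yC e - xA) (topEnd xB yC e - yA)) ≤ xB + yC :=
    max_le (by linarith) (max_le (by linarith) (by linarith))
  rw [edgePrice, abs_le]
  constructor <;> linarith

lemma UDFeasible.exists_Rev_le_menuUtility {xA xB yA yC : ℝ} (h0 : 0 ≤ xA) (h1 : xA < xB)
    (h2 : 0 ≤ yA) (h3 : yA < yC) {u : ℝ × ℝ → ℝ} (hu : UDFeasible xA xB yA yC u) {a b : ℝ}
    (ha : 0 ≤ a) (hb : 0 ≤ b) :
    ∃ s c : Fin 4 → ℝ, (∀ i, -1 ≤ s i ∧ s i ≤ 0) ∧ (∀ i, |c i| ≤ 2 * (xB + yC)) ∧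
      Rev xA xB yA yC (fun _ => a) (fun _ => b) u
        ≤ Rev xA xB yA yC (fun _ => a) (fun _ => b) (menuUtility s c) := by
  obtain ⟨v, hv, hA, huv⟩ := hu.exists_isUtility h1 h3 ha hb
  obtain ⟨s, c, hs, hc, hle⟩ := (hv.threshold xB yC _ _).four_lines h0 h1 h2 h3
  have hm := isUtility_menuUtility c hs
  refine ⟨s, c, hs, fun i => ?_, huv.trans ?_⟩
  · obtain ⟨e, he, hce⟩ := hc i
    have hp := hv.abs_edgePrice_le h0 h1.le h2 h3.le hA he
    have he' : |s i * e| ≤ xB + yC := by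
      rw [abs_mul]
      have h4 : |s i| ≤ 1 := abs_le.2 ⟨(hs i).1, (hs i).2.trans zero_le_one⟩
      have h5 : |e| ≤ xB + yC := abs_le.2 ⟨by linarith [he.1], by linarith [he.2]⟩
      exact (mul_le_mul h4 h5 (abs_nonneg _) zero_le_one).trans_eq (one_mul _)
    rw [← hce, abs_le] at hp
    rw [abs_le] at he' ⊢
    constructor <;> linarith
  · rw [Rev_eq_integral_diagRev hv.lipschitz h1.le h3.le,
      Rev_eq_integral_diagRev hm.lipschitz h1.le h3.le]
    refine mul_le_mul_of_nonneg_right ?_ (mul_nonneg ha hb)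
    refine intervalIntegral.integral_mono_on (by linarith)
      (intervalIntegrable_diagRev hv.lipschitz.continuous h1.le h3.le)
      (intervalIntegrable_diagRev hm.lipschitz.continuous h1.le h3.le) fun t ht => ?_
    refine (hv.diagRev_le h0 h1.le h2 h3.le (hv.nonneg_of_mem_V hA) ht).trans
      ((hle t ht).trans_eq ?_)
    rw [← diagRev_max xA xB yA yC (minLine s c) t]
    rfl

/-- for uniform densities, the optimal unit-demand mechanism consists of
at most 5 menu items, one of which is `(0,0,0)`. -/
theorem stmt16 (xA xB yA yC : ℝ) (h0 : 0 ≤ xA) (h1 : xA < xB) (h2 : 0 ≤ yA) (h3 : yA < yC) :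
    ∃ q1 q2 t : Fin 5 → ℝ,
      (∀ i, 0 ≤ q1 i ∧ 0 ≤ q2 i ∧ q1 i + q2 i ≤ 1) ∧
      (∃ i, q1 i = 0 ∧ q2 i = 0 ∧ t i = 0) ∧
      UDOptimal xA xB yA yC (fun _ => (xB - xA)⁻¹) (fun _ => (yC - yA)⁻¹)
        (fun z => ⨆ i : Fin 5, (q1 i * z.1 + q2 i * z.2 - t i)) := by
  have ha : 0 ≤ (xB - xA)⁻¹ := inv_nonneg.2 (by linarith)
  have hb : 0 ≤ (yC - yA)⁻¹ := inv_nonneg.2 (by linarith)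
  set B := 2 * (xB + yC) with hB
  set K : Set ((Fin 4 → ℝ) × (Fin 4 → ℝ)) :=
    Icc (fun _ => -1) (fun _ => 0) ×ˢ Icc (fun _ => -B) (fun _ => B) with hK
  have hslope : ∀ r ∈ K, ∀ i, -1 ≤ r.1 i ∧ r.1 i ≤ 0 := fun r hr i => ⟨hr.1.1 i, hr.1.2 i⟩
  obtain ⟨r, hr, hmax⟩ := (isCompact_Icc.prod isCompact_Icc : IsCompact K).exists_isMaxOn
    ⟨((fun _ => 0), (fun _ => 0)), ⟨⟨fun _ => by norm_num, le_rfl⟩,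
      ⟨fun _ => by simp only; linarith, fun _ => by simp only; linarith⟩⟩⟩
    ((continuousOn_Rev_menuUtility h1.le h3.le (xB - xA)⁻¹ (yC - yA)⁻¹).mono hslope)
  have hs := hslope r hr
  refine ⟨Fin.cons 0 (fun i => -r.1 i), Fin.cons 0 (fun i => 1 + r.1 i), Fin.cons 0 r.2,
    fun i => ?_, ⟨0, rfl, rfl, rfl⟩, ?_⟩
  · refine Fin.cases (by simp) (fun i => ?_) i
    simp only [Fin.cons_succ]
    exact ⟨by linarith [(hs i).2], by linarith [(hs i).1], by linarith⟩
  · simp only [iSup_menu]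
    have hfeas : UDFeasible xA xB yA yC (menuUtility r.1 r.2) :=
      (isUtility_menuUtility r.2 hs).udFeasible fun _ _ => le_max_left _ _
    refine ⟨hfeas, Eq.symm (IsGreatest.csSup_eq ?_)⟩
    refine ⟨⟨_, hfeas, rfl⟩, ?_⟩
    rintro _ ⟨u, hu, rfl⟩
    obtain ⟨s, c, hs', hc, hle⟩ := hu.exists_Rev_le_menuUtility h0 h1 h2 h3 ha hb
    have hmem : (s, c) ∈ K := ⟨⟨fun i => (hs' i).1, fun i => (hs' i).2⟩,
      ⟨fun i => (abs_le.1 (hc i)).1, fun i => (abs_le.1 (hc i)).2⟩⟩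
    exact hle.trans (isMaxOn_iff.1 hmax (s, c) hmem)
end
end

section
/- Let a < b be real numbers, let q : [a,b] → [0,1] be weakly increasing, and let v : [a,b] → ℝ be continuous. Let x* ∈ [a,b] be a maximizer over [a,b] of the function s ↦ ∫_s^b v(x) dx. Then ∫_a^b q(x)·v(x) dx ≤ q(a)·∫_a^{x*} v(x) dx + ∫_{x*}^b v(x) dx. -/
open MeasureTheory Set

/-- The integral of `v` over a strict superlevel set of a monotone function is the integral over
a right end of the interval. -/
lemma exists_setIntegral_superlevel_eq {a b t : ℝ} {Q : ℝ → ℝ} (hab : a ≤ b) (hQ : Monotone Q)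
    (ht : Q a ≤ t) (v : ℝ → ℝ) :
    ∃ s ∈ Icc a b, ∫ x in Ioc a b ∩ {x | t < Q x}, v x = ∫ x in s..b, v x := by
  set T : Set ℝ := {x | x ∈ Icc a b ∧ Q x ≤ t} with hT
  have haT : a ∈ T := ⟨left_mem_Icc.2 hab, ht⟩
  have hTb : BddAbove T := ⟨b, fun x hx => hx.1.2⟩
  have has : a ≤ sSup T := le_csSup hTb haT
  have hsb : sSup T ≤ b := csSup_le ⟨a, haT⟩ fun x hx => hx.1.2
  refine ⟨sSup T, ⟨has, hsb⟩, ?_⟩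
  have hsub : Ioc (sSup T) b ⊆ Ioc a b ∩ {x | t < Q x} := by
    intro x hx
    refine ⟨⟨has.trans_lt hx.1, hx.2⟩, ?_⟩
    by_contra h
    exact absurd (le_csSup hTb ⟨⟨(has.trans_lt hx.1).le, hx.2⟩, not_lt.1 h⟩) (not_le.2 hx.1)
  have hsup : Ioc a b ∩ {x | t < Q x} ⊆ Icc (sSup T) b := by
    rintro x ⟨hx, hxt⟩
    refine ⟨csSup_le ⟨a, haT⟩ fun y hy => ?_, hx.2⟩
    by_contra h
    exact absurd (hQ (not_le.1 h).le) (not_le.2 (hy.2.trans_lt hxt))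
  rw [intervalIntegral.integral_of_le hsb]
  refine setIntegral_congr_set (Filter.EventuallyLE.antisymm ?_ hsub.eventuallyLE)
  exact hsup.eventuallyLE.trans Ioc_ae_eq_Icc.symm.le

/-- A weighted integral with monotone weight bounded by `1` is controlled by the tail integrals. -/
lemma integral_monotone_sub_mul_le {a b M : ℝ} {Q v : ℝ → ℝ} (hab : a ≤ b) (hQ : Monotone Q)
    (hQ1 : ∀ x, Q x ≤ 1) (hv : IntervalIntegrable v volume a b)
    (hM : ∀ s ∈ Icc a b, (∫ x in s..b, v x) ≤ M) :
    (∫ x in a..b, (Q x - Q a) * v x) ≤ (1 - Q a) * M := by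
  have hvi : Integrable v (volume.restrict (Ioc a b)) :=
    (intervalIntegrable_iff_integrableOn_Ioc_of_le hab).1 hv
  set F : ℝ → ℝ → ℝ := fun x t => {p : ℝ × ℝ | p.2 < Q p.1}.indicator (fun p => v p.1) (x, t)
    with hF
  have hFi : Integrable (Function.uncurry F)
      ((volume.restrict (Ioc a b)).prod (volume.restrict (Ioc (Q a) 1))) :=
    (hvi.comp_fst _).indicator
      (measurableSet_lt measurable_snd (hQ.measurable.comp measurable_fst))
  have hx : ∀ x ∈ Ioc a b, (Q x - Q a) * v x = ∫ t in Ioc (Q a) 1, F x t := by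
    intro x hx
    have h1 : F x = (Iio (Q x)).indicator fun _ => v x := by
      ext t
      simp [hF, indicator_apply]
    have h2 : Ioc (Q a) 1 ∩ Iio (Q x) = Ioo (Q a) (Q x) := by
      ext t
      exact ⟨fun h => ⟨h.1.1, h.2⟩, fun h => ⟨⟨h.1, h.2.le.trans (hQ1 x)⟩, h.2⟩⟩
    rw [h1, setIntegral_indicator measurableSet_Iio, h2, setIntegral_const,
      Real.volume_real_Ioo_of_le (hQ hx.1.le), smul_eq_mul]
  have ht : ∀ t ∈ Ioc (Q a) 1, (∫ x in Ioc a b, F x t) ≤ M := by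
    intro t ht
    have h1 : (fun x => F x t) = {x | t < Q x}.indicator v := by
      ext x
      simp [hF, indicator_apply]
    rw [h1, setIntegral_indicator (measurableSet_lt measurable_const hQ.measurable)]
    obtain ⟨s, hs, h⟩ := exists_setIntegral_superlevel_eq hab hQ ht.1.le v
    exact h ▸ hM s hs
  rw [intervalIntegral.integral_of_le hab, setIntegral_congr_fun measurableSet_Ioc hx,
    integral_integral_swap hFi]
  calc (∫ t in Ioc (Q a) 1, ∫ x in Ioc a b, F x t)
      ≤ ∫ _ in Ioc (Q a) 1, M :=
        setIntegral_mono_on hFi.integral_prod_right (integrable_const M) measurableSet_Ioc ht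
    _ = (1 - Q a) * M := by
        rw [setIntegral_const, Real.volume_real_Ioc_of_le (hQ1 a), smul_eq_mul]

/-- for weakly increasing `q : [a,b] → [0,1]`, continuous `v`, and a
maximizer `x*` of `s ↦ ∫_s^b v`, one has
`∫_a^b q·v ≤ q(a)·∫_a^{x*} v + ∫_{x*}^b v`. -/
theorem stmt18 (a b : ℝ) (hab : a < b) (q v : ℝ → ℝ)
    (hq01 : ∀ x ∈ Set.Icc a b, q x ∈ Set.Icc (0:ℝ) 1)
    (hqmono : MonotoneOn q (Set.Icc a b))
    (hv : ContinuousOn v (Set.Icc a b))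
    (xs : ℝ) (hxs : xs ∈ Set.Icc a b)
    (hmax : ∀ s ∈ Set.Icc a b, (∫ x in s..b, v x) ≤ ∫ x in xs..b, v x) :
    (∫ x in a..b, q x * v x) ≤ q a * (∫ x in a..xs, v x) + ∫ x in xs..b, v x := by
  set Q : ℝ → ℝ := fun x => q (projIcc a b hab.le x) with hQdef
  have hQ : Monotone Q := fun x y hxy =>
    hqmono (Subtype.coe_prop _) (Subtype.coe_prop _) (monotone_projIcc hab.le hxy)
  have hQq : ∀ x ∈ Icc a b, Q x = q x := fun x hx => by simp [hQdef, projIcc_of_mem hab.le hx]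
  have hQa : Q a = q a := hQq a (left_mem_Icc.2 hab.le)
  have hvi : IntervalIntegrable v volume a b := hv.intervalIntegrable_of_Icc hab.le
  have key := integral_monotone_sub_mul_le hab.le hQ (fun x => (hq01 _ (Subtype.coe_prop _)).2)
    hvi hmax
  have hQv : IntervalIntegrable (fun x => Q x * v x) volume a b :=
    (hQ.intervalIntegrable).mul_continuousOn (by rwa [uIcc_of_le hab.le])
  have hcongr : (∫ x in a..b, q x * v x) = ∫ x in a..b, Q x * v x :=
    intervalIntegral.integral_congr fun x hx => by
      rw [uIcc_of_le hab.le] at hx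
      simp only [hQq x hx]
  have hsplit : (∫ x in a..xs, v x) + ∫ x in xs..b, v x = ∫ x in a..b, v x :=
    intervalIntegral.integral_add_adjacent_intervals
      (hvi.mono_set (by
        rw [uIcc_of_le hab.le, uIcc_of_le hxs.1]; exact Icc_subset_Icc le_rfl hxs.2))
      (hvi.mono_set (by
        rw [uIcc_of_le hab.le, uIcc_of_le hxs.2]; exact Icc_subset_Icc hxs.1 le_rfl))
  simp only [sub_mul] at key
  rw [intervalIntegral.integral_sub hQv (hvi.const_mul _), intervalIntegral.integral_const_mul,
    ← hsplit, hQa] at key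
  rw [hcongr]
  linarith
end
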